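/- arXiv:2004.14000 — 5 statements merged into one kernel-verified Lean document; each statement's English description precedes it below -/
import Mathlib

section
/- For every positive integer k, the number k+3 does not divide 2(k+1) + k(k+1)/2 (equivalently, k+3 does not divide T_{k+2} - 1, where T_m = m(m+1)/2). Consequently there is no positive integer k such that 2+k+1 divides the sum 2 + 3 + ... + (2+k), i.e., A(2) does not exist. -/
/-- Twice `2 + 3 + ... + (2+k)` is `(k+3)(k+2) - 2`, so `k+3` dividing that sum would divide `2`. -/
lemma not_add_three_dvd_sum (k : ℕ) : ¬ (k + 3) ∣ (2 * (k + 1) + k * (k + 1) / 2) := by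
  intro h
  have hhalf : 2 * (k * (k + 1) / 2) = k * (k + 1) :=
    Nat.mul_div_cancel' (Nat.even_mul_succ_self k).two_dvd
  have htwice : 2 * (2 * (k + 1) + k * (k + 1) / 2) + 2 = (k + 3) * (k + 2) := by
    rw [mul_add, hhalf]
    ring
  have htwo : (k + 3) ∣ 2 :=
    (Nat.dvd_add_right (h.mul_left 2)).mp (htwice ▸ dvd_mul_right (k + 3) (k + 2))
  have := Nat.le_of_dvd two_pos htwo
  omega

lemma sum_range_two_add (k : ℕ) :
    ∑ i ∈ Finset.range (k + 1), (2 + i) = 2 * (k + 1) + k * (k + 1) / 2 := by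
  rw [Finset.sum_add_distrib, Finset.sum_range_id]
  simp [mul_comm]

/-- For every positive integer `k`, the number `k+3` does not divide
`2(k+1) + k(k+1)/2` (the sum `2 + 3 + ... + (2+k)`); consequently there is no
positive integer `k` such that `2+k+1` divides `2 + 3 + ... + (2+k)`,
i.e. `A(2)` does not exist. -/
theorem A2_does_not_exist :
    (∀ k : ℕ, 0 < k → ¬ ((k + 3) ∣ (2 * (k + 1) + k * (k + 1) / 2))) ∧
    ¬ ∃ k : ℕ, 0 < k ∧ (2 + k + 1) ∣ (∑ i ∈ Finset.range (k + 1), (2 + i)) := by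
  refine ⟨fun k _ => not_add_three_dvd_sum k, ?_⟩
  rintro ⟨k, -, h⟩
  rw [sum_range_two_add, show 2 + k + 1 = k + 3 by ring] at h
  exact not_add_three_dvd_sum k h
end

section
/- Let S ≥ 1 be an integer and suppose 2S = d·e where d is an odd positive integer and e = 2S/d. Set k = (max(d,e) - min(d,e) - 1)/2 and m = (max(d,e) + min(d,e) - 1)/2. Then k and m are nonnegative integers and S = T_m - T_k. -/
/-- The triangular number `T m = m(m+1)/2`. -/
def T (m : ℕ) : ℕ := m * (m + 1) / 2

theorem two_mul_T (n : ℕ) : 2 * T n = n * (n + 1) :=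
  Nat.two_mul_div_two_of_even (Nat.even_mul_succ_self n)

/-- Adding `a` consecutive integers `k + 1, …, k + a` to `T k` gives `T (k + a)`. -/
theorem two_mul_T_add (a k : ℕ) : 2 * T (k + a) = 2 * T k + a * (a + 2 * k + 1) := by
  rw [two_mul_T, two_mul_T]
  ring

/-- For `S ≥ 1` and `2S = d·e` with `d` odd, setting
`k = (max(d,e) - min(d,e) - 1)/2` and `m = (max(d,e) + min(d,e) - 1)/2`,
the quantities `k` and `m` are nonnegative integers (the divisions by 2 are exact)
and `S = T m - T k`. -/
theorem nyblom_representation (S d e k m : ℕ) (hS : 1 ≤ S) (hd : Odd d)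
    (hde : 2 * S = d * e)
    (hk : k = (max d e - min d e - 1) / 2)
    (hm : m = (max d e + min d e - 1) / 2) :
    2 * k = max d e - min d e - 1 ∧
    2 * m = max d e + min d e - 1 ∧
    T k + S = T m := by
  have he : Even e := by
    have h : Even (d * e) := hde ▸ even_two_mul S
    exact (Nat.even_mul.mp h).resolve_left (Nat.not_even_iff_odd.mpr hd)
  obtain ⟨x, rfl⟩ := hd
  obtain ⟨y, rfl⟩ := he
  rw [← min_mul_max (2 * x + 1)] at hde
  generalize ha : min (2 * x + 1) (y + y) = a at *
  generalize hb : max (2 * x + 1) (y + y) = b at *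
  have hba : b = a + 2 * k + 1 := by omega
  have hmk : m = k + a := by omega
  refine ⟨by omega, by omega, ?_⟩
  have h := two_mul_T_add a k
  rw [← hba, ← hde, ← hmk] at h
  omega
end

section
/- For every integer n ≥ 1, β(n) = B(n) + 1, where B(n) is the smallest positive integer k such that n+k+1 divides n(n+1)···(n+k), and β(n) is the smallest positive integer κ such that n+κ divides κ!. -/
/-- Modulo `n + k`, the product `n(n+1)⋯(n+k-1)` is `k!` up to sign. -/
lemma add_dvd_prod_range_add_iff_dvd_factorial (n k : ℕ) :
    (n + k) ∣ (∏ i ∈ Finset.range k, (n + i)) ↔ (n + k) ∣ Nat.factorial k := by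
  have key : ((∏ i ∈ Finset.range k, (n + i) : ℕ) : ZMod (n + k))
      = (-1) ^ k * (Nat.factorial k : ZMod (n + k)) := by
    rw [← Finset.prod_range_add_one_eq_factorial, ← Finset.prod_range_reflect (fun i => i + 1) k]
    push_cast
    rw [← Finset.card_range k, ← Finset.prod_const, Finset.card_range, ← Finset.prod_mul_distrib]
    refine Finset.prod_congr rfl fun i hi => ?_
    have hik : i < k := Finset.mem_range.mp hi
    have hsum : ((n + i + (k - 1 - i + 1) : ℕ) : ZMod (n + k)) = 0 := by
      rw [show n + i + (k - 1 - i + 1) = n + k by omega, ZMod.natCast_self]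
    push_cast at hsum
    linear_combination hsum
  rw [← ZMod.natCast_eq_zero_iff, ← ZMod.natCast_eq_zero_iff, key]
  exact (isUnit_one.neg.pow k).mul_right_eq_zero

lemma exists_pos_add_dvd_factorial (n : ℕ) : ∃ κ : ℕ, 0 < κ ∧ (n + κ) ∣ Nat.factorial κ := by
  refine ⟨n ^ 2 + 2 * n + 2, by positivity, ?_⟩
  have hle : n + 2 ≤ n ^ 2 + 2 * n + 2 := by nlinarith
  refine dvd_trans ⟨Nat.factorial n, ?_⟩ (Nat.factorial_dvd_factorial hle)
  rw [Nat.factorial_succ, Nat.factorial_succ]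
  ring

/-- For every `n ≥ 1`, `β(n) = B(n) + 1`, where `B(n)` is the smallest
positive `k` with `n+k+1 ∣ n(n+1)⋯(n+k)` and `β(n)` is the smallest positive `κ`
with `n+κ ∣ κ!`. -/
theorem beta_eq_B_succ (n : ℕ) (hn : 1 ≤ n) :
    sInf {κ : ℕ | 0 < κ ∧ (n + κ) ∣ Nat.factorial κ}
      = sInf {k : ℕ | 0 < k ∧ (n + k + 1) ∣ (∏ i ∈ Finset.range (k + 1), (n + i))} + 1 := by
  have hpos : 1 ≤ sInf {κ : ℕ | 0 < κ ∧ (n + κ) ∣ Nat.factorial κ} :=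
    le_csInf (exists_pos_add_dvd_factorial n) fun _ h => h.1
  rw [← Nat.sInf_add hpos]
  congr 2
  ext k
  simp only [Set.mem_ofPred_eq, add_assoc n k 1, add_dvd_prod_range_add_iff_dvd_factorial]
  refine ⟨fun h => ⟨Nat.pos_of_ne_zero ?_, h.2⟩, fun h => ⟨k.succ_pos, h.2⟩⟩
  rintro rfl
  have hdvd := h.2
  simp at hdvd
  omega
end

section
/- Let n ≥ 1, ℓ ≥ 1, L = 10^ℓ, and let k ≥ 0 and δ ≥ 1 be integers such that L/10 ≤ n+k+1 and n+k+δ < L (so that each of the integers n+k+1, ..., n+k+δ has exactly ℓ decimal digits). Then c_n(k+δ) = L^δ · c_n(k) + (n+k+1)·(L^δ - 1)/(L - 1) + (L^δ - δL + δ - 1)/(L - 1)^2, where (L^δ - 1)/(L-1) and (L^δ - δL + δ - 1)/(L-1)^2 are integers. -/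
/-- `concat n i` is the decimal concatenation `n ∥ n+1 ∥ ... ∥ n+i`:
`c_n(0) = n` and `c_n(i) = c_n(i-1)·10^{d(n+i)} + (n+i)`, where `d(m)` is the number of
decimal digits of `m`. -/
def concat (n : ℕ) : ℕ → ℕ
  | 0 => n
  | i + 1 => concat n i * 10 ^ (Nat.digits 10 (n + i + 1)).length + (n + i + 1)

theorem length_digits_ten_eq {m ℓ : ℕ} (hℓ : 1 ≤ ℓ) (h1 : 10 ^ ℓ / 10 ≤ m) (h2 : m < 10 ^ ℓ) :
    (Nat.digits 10 m).length = ℓ := by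
  obtain ⟨j, rfl⟩ : ∃ j, ℓ = j + 1 := ⟨ℓ - 1, by omega⟩
  rw [pow_succ, Nat.mul_div_cancel _ (by norm_num)] at h1
  apply le_antisymm
  · exact (Nat.digits_length_le_iff (by norm_num) m).2 h2
  · exact (Nat.lt_digits_length_iff (by norm_num) m).2 h1

/-- Subtraction-free form of the closed formula: `g` is `(L^δ - 1)/(L - 1)` and `s` is
`(L^δ - δL + δ - 1)/(L - 1)^2`, where `L = M + 1`. -/
theorem concat_add_eq {n ℓ M k : ℕ} (hℓ : 1 ≤ ℓ) (hL : M + 1 = 10 ^ ℓ)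
    (h1 : 10 ^ ℓ / 10 ≤ n + k + 1) (δ : ℕ) (h2 : n + k + δ < 10 ^ ℓ) :
    ∃ g s, M * g + 1 = (M + 1) ^ δ ∧ M ^ 2 * s + δ * (M + 1) + 1 = (M + 1) ^ δ + δ ∧
      concat n (k + δ) = (M + 1) ^ δ * concat n k + (n + k + 1) * g + s := by
  induction δ with
  | zero => exact ⟨0, 0, by simp⟩
  | succ δ ih =>
    obtain ⟨g, s, hg, hs, hc⟩ := ih (by omega)
    refine ⟨(M + 1) * g + 1, (M + 1) * s + δ, ?_, ?_, ?_⟩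
    · rw [pow_succ, ← hg]; ring
    · rw [pow_succ]
      linear_combination (M + 1) * hs
    · rw [← add_assoc k δ 1, concat,
        length_digits_ten_eq hℓ (m := n + (k + δ) + 1) (by omega) (by omega), ← hL, hc]
      ring

theorem mul_le_pow_of_le {δ L : ℕ} (hδ : 1 ≤ δ) (h : δ ≤ L) : δ * L ≤ L ^ δ := by
  obtain rfl | hδ2 := hδ.eq_or_lt
  · simp
  · calc δ * L ≤ L ^ 2 := by rw [sq]; exact Nat.mul_le_mul_right L h
      _ ≤ L ^ δ := Nat.pow_le_pow_right (by omega) hδ2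

/-- Let `n ≥ 1`, `ℓ ≥ 1`, `L = 10^ℓ`, and let `k ≥ 0`, `δ ≥ 1` with
`L/10 ≤ n+k+1` and `n+k+δ < L` (so each of `n+k+1, ..., n+k+δ` has exactly `ℓ` digits).
Then `c_n(k+δ) = L^δ·c_n(k) + (n+k+1)·(L^δ-1)/(L-1) + (L^δ - δL + δ - 1)/(L-1)^2`,
where `(L^δ-1)/(L-1)` and `(L^δ - δL + δ - 1)/(L-1)^2` are integers. -/
theorem concat_decade_formula (n ℓ L k δ : ℕ) (hn : 1 ≤ n) (hℓ : 1 ≤ ℓ)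
    (hL : L = 10 ^ ℓ) (hδ : 1 ≤ δ) (h1 : L / 10 ≤ n + k + 1) (h2 : n + k + δ < L) :
    ((L - 1) ∣ (L ^ δ - 1)) ∧
    ((L - 1) ^ 2 ∣ (L ^ δ - δ * L + δ - 1)) ∧
    concat n (k + δ) =
      L ^ δ * concat n k + (n + k + 1) * ((L ^ δ - 1) / (L - 1))
        + (L ^ δ - δ * L + δ - 1) / (L - 1) ^ 2 := by
  have hL10 : 10 ≤ L := hL ▸ Nat.le_self_pow (by omega) 10
  obtain ⟨M, rfl⟩ : ∃ M, L = M + 1 := ⟨L - 1, by omega⟩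
  obtain ⟨g, s, hg, hs, hc⟩ := concat_add_eq hℓ hL (hL ▸ h1) δ (hL ▸ h2)
  have hle := mul_le_pow_of_le hδ (show δ ≤ M + 1 by omega)
  have hg' : (M + 1) ^ δ - 1 = M * g := by omega
  have hs' : (M + 1) ^ δ - δ * (M + 1) + δ - 1 = M ^ 2 * s := by omega
  have hM : 0 < M := by omega
  rw [hg', hs', Nat.add_sub_cancel, Nat.mul_div_cancel_left _ hM,
    Nat.mul_div_cancel_left _ (pow_pos hM 2)]
  exact ⟨dvd_mul_right _ _, dvd_mul_right _ _, hc⟩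
end

section
/- Let n ≥ 1, ℓ ≥ 1, L = 10^ℓ, and let k ≥ 0 and q ≥ 1 be integers with L/10 ≤ n+k+1 and n+k+q < L, and suppose q divides n+k+1. Then c_n(k+q) ≡ a·c_n(k) + b (mod q), where a = L^q mod q and b = ((L^q - qL + q - 1)/(L-1)^2) mod q (the quantity (L^q - qL + q - 1)/(L-1)^2 being an integer). -/
/-- The weighted geometric sum `∑_{j < m} j * L ^ (m - 1 - j)`, in Horner form. -/
def weightedGeomSum (L : ℕ) : ℕ → ℕ
  | 0 => 0
  | m + 1 => weightedGeomSum L m * L + m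

theorem weightedGeomSum_mul_sq (x m : ℕ) :
    weightedGeomSum (x + 1) m * x ^ 2 + m * x + 1 = (x + 1) ^ m := by
  induction m with
  | zero => simp [weightedGeomSum]
  | succ m ih =>
    rw [pow_succ (x + 1), ← ih, weightedGeomSum]
    ring

theorem le_weightedGeomSum_succ (L m : ℕ) : m ≤ weightedGeomSum L (m + 1) :=
  Nat.le_add_left _ _

theorem weightedGeomSum_mul_sub_one_sq {L q : ℕ} (hL : 2 ≤ L) (hq : 1 ≤ q) :
    L ^ q - q * L + q - 1 = (L - 1) ^ 2 * weightedGeomSum L q := by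
  obtain ⟨x, rfl⟩ : ∃ x, L = x + 1 := ⟨L - 1, by omega⟩
  obtain ⟨m, rfl⟩ : ∃ m, q = m + 1 := ⟨q - 1, by omega⟩
  have hsum := weightedGeomSum_mul_sq x (m + 1)
  have hle := le_weightedGeomSum_succ (x + 1) m
  have hmul : weightedGeomSum (x + 1) (m + 1) ≤ weightedGeomSum (x + 1) (m + 1) * x ^ 2 :=
    Nat.le_mul_of_pos_right _ (pow_pos (by omega) 2)
  rw [Nat.add_sub_cancel, mul_comm (x ^ 2), mul_add (m + 1) x 1]
  omega

theorem length_digits_of_pow_div_le {ℓ m : ℕ} (hℓ : 1 ≤ ℓ) (hlow : 10 ^ ℓ / 10 ≤ m)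
    (hhigh : m < 10 ^ ℓ) : (Nat.digits 10 m).length = ℓ := by
  obtain ⟨r, rfl⟩ : ∃ r, ℓ = r + 1 := ⟨ℓ - 1, by omega⟩
  rw [pow_succ, Nat.mul_div_cancel _ (by norm_num)] at hlow
  refine le_antisymm ((Nat.digits_length_le_iff (by norm_num) m).2 hhigh) ?_
  exact (Nat.lt_digits_length_iff (by norm_num) m).2 hlow

theorem concat_add_modEq {n ℓ k q m : ℕ} (hℓ : 1 ≤ ℓ) (hlow : 10 ^ ℓ / 10 ≤ n + k + 1)
    (hhigh : n + k + m < 10 ^ ℓ) (hdvd : q ∣ n + k + 1) :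
    concat n (k + m) ≡ (10 ^ ℓ) ^ m * concat n k + weightedGeomSum (10 ^ ℓ) m [MOD q] := by
  induction m with
  | zero => simpa [weightedGeomSum] using Nat.ModEq.refl _
  | succ m ih =>
    have hlen : (Nat.digits 10 (n + (k + m) + 1)).length = ℓ :=
      length_digits_of_pow_div_le hℓ (by omega) (by omega)
    have hlast : n + (k + m) + 1 ≡ m [MOD q] := by
      have h := ((Nat.modEq_zero_iff_dvd).2 hdvd).add_right m
      rwa [zero_add, show n + k + 1 + m = n + (k + m) + 1 by ring] at h
    rw [← add_assoc, concat, hlen, weightedGeomSum]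
    refine (((ih (by omega)).mul_right _).add hlast).trans ?_
    rw [show ((10 ^ ℓ) ^ m * concat n k + weightedGeomSum (10 ^ ℓ) m) * 10 ^ ℓ + m =
      (10 ^ ℓ) ^ (m + 1) * concat n k + (weightedGeomSum (10 ^ ℓ) m * 10 ^ ℓ + m) by ring]

/-- Let `n ≥ 1`, `ℓ ≥ 1`, `L = 10^ℓ`, and let `k ≥ 0`, `q ≥ 1` with
`L/10 ≤ n+k+1` and `n+k+q < L`, and suppose `q` divides `n+k+1`. Then
`c_n(k+q) ≡ a·c_n(k) + b (mod q)`, where `a = L^q mod q` and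
`b = ((L^q - qL + q - 1)/(L-1)^2) mod q`, the quantity `(L^q - qL + q - 1)/(L-1)^2`
being an integer. -/
theorem concat_incremental_formula (n ℓ L k q : ℕ) (hn : 1 ≤ n) (hℓ : 1 ≤ ℓ)
    (hL : L = 10 ^ ℓ) (hq : 1 ≤ q) (h1 : L / 10 ≤ n + k + 1) (h2 : n + k + q < L)
    (hdvd : q ∣ n + k + 1) :
    ((L - 1) ^ 2 ∣ (L ^ q - q * L + q - 1)) ∧
    concat n (k + q) ≡
      (L ^ q % q) * concat n k + ((L ^ q - q * L + q - 1) / (L - 1) ^ 2) % q [MOD q] := by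
  subst hL
  have hL2 : 2 ≤ 10 ^ ℓ :=
    le_trans (by norm_num) (Nat.pow_le_pow_right (by norm_num) hℓ : 10 ^ 1 ≤ 10 ^ ℓ)
  rw [weightedGeomSum_mul_sub_one_sq hL2 hq,
    Nat.mul_div_cancel_left _ (pow_pos (by omega : 0 < 10 ^ ℓ - 1) 2)]
  refine ⟨dvd_mul_right _ _, (concat_add_modEq hℓ h1 h2 hdvd).trans ?_⟩
  exact ((Nat.mod_modEq _ _).symm.mul_right _).add (Nat.mod_modEq _ _).symm
end
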